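/- In the boundary case p(n) = n, the log determinant of the sample covariance matrix satisfies (log det Σ̂ − log (n−1)! + n log n − log det Σ)/√(2 log n) → N(0,1) in distribution as n → ∞. -/

import Mathlib

open MeasureTheory ProbabilityTheory Filter Matrix

/-- `ν` is the multivariate Gaussian distribution `N_p(m, S)` on `ℝ^p`: it is a probability
measure and the pushforward under any linear functional `x ↦ ⟨l, x⟩` is the univariate
Gaussian with mean `⟨l, m⟩` and variance `lᵀ S l`. -/
def IsMvGaussian {p : ℕ} (m : Fin p → ℝ) (S : Matrix (Fin p) (Fin p) ℝ)
    (ν : Measure (Fin p → ℝ)) : Prop :=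
  IsProbabilityMeasure ν ∧
    ∀ l : Fin p → ℝ,
      ν.map (fun x => ∑ i, l i * x i) =
        gaussianReal (∑ i, l i * m i) (Real.toNNReal (l ⬝ᵥ (S *ᵥ l)))

/-- The sample covariance matrix `Σ̂` based on the `n+1` observations `X 0, …, X n`. -/
noncomputable def sampleCov {n p : ℕ} (X : Fin (n + 1) → Fin p → ℝ) :
    Matrix (Fin p) (Fin p) ℝ :=
  Matrix.of fun i j =>
    (1 / (n : ℝ)) * ∑ k, (X k i - (∑ l, X l i) / (n + 1)) * (X k j - (∑ l, X l j) / (n + 1))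

/-- The standard Gaussian cumulative distribution function. -/
noncomputable def stdGaussianCDF (x : ℝ) : ℝ := (gaussianReal 0 1 (Set.Iic x)).toReal

/-- The Mellin transform `E[(χ²_j)^s]` of the chi-square law with `j` degrees of freedom. -/
noncomputable def chiSqMellin (j : ℕ) (s : ℂ) : ℂ :=
  2 ^ s * Complex.Gamma (j / 2 + s) / Complex.Gamma (j / 2)

/-- The second order approximation of the logarithm of `chiSqMellin j s` around `s = 0`. -/
noncomputable def chiSqMellinExponent (j : ℕ) (s : ℂ) : ℂ :=
  s * (Real.log j - 1 / j) + s ^ 2 / j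

/-- The increment of `log (chiSqMellin j s) - chiSqMellinExponent j s` from `j` to `j + 2`. -/
noncomputable def chiSqMellinDefect (j : ℕ) (s : ℂ) : ℂ :=
  Complex.log (1 + 2 * s / j) + (chiSqMellinExponent j s - chiSqMellinExponent (j + 2) s)

lemma chiSqMellin_add_two {j : ℕ} (hj : 0 < j) {s : ℂ} (hs : s.re = 0) :
    chiSqMellin (j + 2) s = (1 + 2 * s / j) * chiSqMellin j s := by
  have hj' : (j : ℂ) ≠ 0 := by exact_mod_cast hj.ne'
  have hjr : (0 : ℝ) < j := by exact_mod_cast hj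
  have h1 : (j / 2 + s : ℂ) ≠ 0 := by
    intro h
    have := congrArg Complex.re h
    simp [hs] at this
    omega
  have h2 : Complex.Gamma (j / 2) ≠ 0 := by
    apply Complex.Gamma_ne_zero_of_re_pos
    simpa using hjr
  unfold chiSqMellin
  have e1 : (((j + 2 : ℕ) : ℂ) / 2 + s) = (j / 2 + s) + 1 := by push_cast; ring
  have e2 : (((j + 2 : ℕ) : ℂ) / 2) = (j / 2) + 1 := by push_cast; ring
  rw [e1, e2, Complex.Gamma_add_one _ h1, Complex.Gamma_add_one _ (by simpa using hj.ne')]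
  field_simp

lemma chiSqMellin_mul_exp_add_two {j : ℕ} (hj : 0 < j) {s : ℂ} (hs : s.re = 0) :
    chiSqMellin (j + 2) s * Complex.exp (-chiSqMellinExponent (j + 2) s) =
      Complex.exp (chiSqMellinDefect j s) *
        (chiSqMellin j s * Complex.exp (-chiSqMellinExponent j s)) := by
  have h1 : (1 + 2 * s / j : ℂ) ≠ 0 := by
    intro h
    have := congrArg Complex.re h
    rw [Complex.add_re, Complex.div_natCast_re] at this
    simp [hs] at this
  rw [chiSqMellin_add_two hj hs, chiSqMellinDefect, Complex.exp_add, Complex.exp_log h1,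
    sub_eq_add_neg, Complex.exp_add, Complex.exp_neg (chiSqMellinExponent j s)]
  field_simp

lemma norm_chiSqMellinDefect_le {j : ℕ} (hj : 0 < j) {s : ℂ} (hs : ‖s‖ ≤ 1 / 4) :
    ‖chiSqMellinDefect j s‖ ≤ 20 * ‖s‖ / (j : ℝ) ^ 3 := by
  have hj1 : (1 : ℝ) ≤ j := by exact_mod_cast hj
  have hj' : (j : ℂ) ≠ 0 := by exact_mod_cast hj.ne'
  have hj2 : (j : ℂ) + 2 ≠ 0 := by exact_mod_cast (by omega : j + 2 ≠ 0)
  set z : ℂ := 2 * s / j with hz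
  set w : ℂ := -2 / (j + 2 : ℂ) with hw
  have hzn : ‖z‖ = 2 * ‖s‖ / j := by simp [hz]
  have hwn : ‖w‖ = 2 / (j + 2) := by
    rw [hw, norm_div,
      show (j + 2 : ℂ) = ((j + 2 : ℝ) : ℂ) by push_cast; rfl, Complex.norm_real,
      Real.norm_of_nonneg (by positivity)]
    simp
  have hz1 : ‖z‖ ≤ 1 / 2 := by
    rw [hzn, div_le_iff₀ (by positivity)]; nlinarith
  have hw1 : ‖w‖ ≤ 2 / 3 := by
    rw [hwn, div_le_div_iff₀ (by positivity) (by positivity)]; nlinarith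
  have t1 := Complex.norm_log_sub_logTaylor_le 2 (z := z) (by linarith)
  have t2 := Complex.norm_log_sub_logTaylor_le 2 (z := w) (by linarith)
  have lt (x : ℂ) : Complex.logTaylor (2 + 1) x = x - x ^ 2 / 2 := by
    simp [Complex.logTaylor_succ, Complex.logTaylor_zero]; ring
  rw [lt] at t1 t2
  have b1 : ‖z‖ ^ (2 + 1) * (1 - ‖z‖)⁻¹ / ((2 : ℕ) + 1 : ℝ) ≤ 6 * ‖s‖ / (j : ℝ) ^ 3 := by
    have : (1 - ‖z‖)⁻¹ ≤ 2 := by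
      rw [inv_le_comm₀ (by linarith) (by norm_num)]; linarith
    calc _ ≤ ‖z‖ ^ (2 + 1) * 2 / ((2 : ℕ) + 1 : ℝ) := by gcongr
      _ = 16 / 3 * ‖s‖ ^ 3 / j ^ 3 := by rw [hzn]; push_cast; ring
      _ ≤ _ := by
        gcongr
        · norm_num
        · exact pow_le_of_le_one (norm_nonneg s) (by linarith) (by norm_num)
  have b2 : ‖w‖ ^ (2 + 1) * (1 - ‖w‖)⁻¹ / ((2 : ℕ) + 1 : ℝ) ≤ 8 / (j : ℝ) ^ 3 := by
    have : (1 - ‖w‖)⁻¹ ≤ 3 := by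
      rw [inv_le_comm₀ (by linarith) (by norm_num)]; linarith
    calc _ ≤ ‖w‖ ^ (2 + 1) * 3 / ((2 : ℕ) + 1 : ℝ) := by gcongr
      _ = 8 / (j + 2 : ℝ) ^ 3 := by rw [hwn]; push_cast; field_simp; norm_num
      _ ≤ _ := by gcongr; linarith
  have hlog : ((Real.log j : ℝ) : ℂ) - (Real.log (j + 2 : ℕ) : ℝ) = Complex.log (1 + w) := by
    have : (1 + w : ℂ) = ((j / (j + 2) : ℝ) : ℂ) := by
      rw [hw]; push_cast; field_simp; ring
    rw [this, ← Complex.ofReal_log (by positivity), Real.log_div (by positivity) (by positivity)]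
    push_cast; rfl
  have key : chiSqMellinDefect j s = (Complex.log (1 + z) - (z - z ^ 2 / 2)) +
      s * (Complex.log (1 + w) - (w - w ^ 2 / 2)) + (4 * s / (j * (j + 2) ^ 2) -
        4 * s ^ 2 / (j ^ 2 * (j + 2))) := by
    rw [← hlog, chiSqMellinDefect, chiSqMellinExponent, chiSqMellinExponent, ← hz]
    have e : z - z ^ 2 / 2 + s * (w - w ^ 2 / 2) + (s ^ 2 - s) * (1 / j - 1 / (j + 2)) =
        4 * s / (j * (j + 2) ^ 2) - 4 * s ^ 2 / (j ^ 2 * (j + 2)) := by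
      rw [hz, hw]; field_simp; ring
    rw [← e]; push_cast; ring
  rw [key]
  have b3 : ‖4 * s / (j * (j + 2) ^ 2 : ℂ)‖ ≤ 4 * ‖s‖ / j ^ 3 := by
    rw [norm_div, norm_mul, norm_mul, norm_pow,
      show (j + 2 : ℂ) = ((j + 2 : ℝ) : ℂ) by push_cast; rfl, Complex.norm_real,
      Real.norm_of_nonneg (by positivity)]
    simp only [Complex.norm_ofNat, Complex.norm_natCast]
    gcongr
    nlinarith
  have b4 : ‖4 * s ^ 2 / (j ^ 2 * (j + 2) : ℂ)‖ ≤ 1 * ‖s‖ / j ^ 3 := by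
    rw [norm_div, norm_mul, norm_mul, norm_pow, norm_pow,
      show (j + 2 : ℂ) = ((j + 2 : ℝ) : ℂ) by push_cast; rfl, Complex.norm_real,
      Real.norm_of_nonneg (by positivity)]
    simp only [Complex.norm_ofNat, Complex.norm_natCast]
    have h1 : 4 * ‖s‖ ^ 2 ≤ 1 * ‖s‖ := by nlinarith [norm_nonneg s]
    have h2 : (j : ℝ) ^ 3 ≤ j ^ 2 * (j + 2) := by nlinarith [sq_nonneg (j : ℝ)]
    exact div_le_div₀ (by positivity) h1 (by positivity) h2
  have b5 : ‖s * (Complex.log (1 + w) - (w - w ^ 2 / 2))‖ ≤ ‖s‖ * (8 / j ^ 3) := by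
    rw [norm_mul]; gcongr; exact t2.trans b2
  calc _ ≤ 6 * ‖s‖ / (j : ℝ) ^ 3 + ‖s‖ * (8 / j ^ 3) + (4 * ‖s‖ / j ^ 3 + 1 * ‖s‖ / j ^ 3) :=
        norm_add_le_of_le (norm_add_le_of_le (t1.trans b1) b5) (norm_sub_le_of_le b3 b4)
    _ = 19 * ‖s‖ / j ^ 3 := by ring
    _ ≤ _ := by gcongr; norm_num

lemma tendsto_Gamma_add_natCast_div {z : ℂ} (hz : 0 < z.re) :
    Tendsto (fun M : ℕ => Complex.Gamma (z + (M + 1 : ℕ)) / ((M : ℂ) ^ z * M.factorial))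
      atTop (nhds 1) := by
  have hG := Complex.Gamma_ne_zero_of_re_pos hz
  have hk (k : ℕ) : z + k ≠ 0 := by
    intro h
    have := congrArg Complex.re h
    simp at this
    have : (0 : ℝ) ≤ k := by positivity
    linarith
  have h := (tendsto_const_nhds (x := Complex.Gamma z)).div (Complex.GammaSeq_tendsto_Gamma z) hG
  rw [div_self hG] at h
  refine h.congr fun M => ?_
  have hp : Complex.Gamma (z + (M + 1 : ℕ)) =
      (∏ k ∈ Finset.range (M + 1), (z + k)) * Complex.Gamma z := by
    generalize M + 1 = m
    induction m with
    | zero => simp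
    | succ m ih =>
      rw [Finset.prod_range_succ, show z + ((m + 1 : ℕ) : ℂ) = (z + m) + 1 by push_cast; ring,
        Complex.Gamma_add_one _ (hk m), ih]
      ring
  rw [Pi.div_apply, hp, Complex.GammaSeq, div_div_eq_mul_div, mul_comm (Complex.Gamma z)]

lemma tendsto_Gamma_ratio {x s : ℂ} (hx : 0 < x.re) (hs : s.re = 0) :
    Tendsto (fun M : ℕ => Complex.Gamma (x + s + (M + 1 : ℕ)) / Complex.Gamma (x + (M + 1 : ℕ)) *
      (M : ℂ) ^ (-s)) atTop (nhds 1) := by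
  have h := (tendsto_Gamma_add_natCast_div (z := x + s) (by simpa [hs] using hx)).div
    (tendsto_Gamma_add_natCast_div hx) one_ne_zero
  rw [div_one] at h
  refine h.congr' ?_
  filter_upwards [eventually_ne_atTop 0] with M hM
  have hM' : (M : ℂ) ≠ 0 := by exact_mod_cast hM
  have hf : (M.factorial : ℂ) ≠ 0 := by exact_mod_cast M.factorial_ne_zero
  have hc (y : ℂ) : (M : ℂ) ^ y ≠ 0 := by simp [Complex.cpow_eq_zero_iff, hM']
  simp only [Pi.div_apply]
  rw [Complex.cpow_add _ _ hM', Complex.cpow_neg]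
  have := hc x
  have := hc s
  field_simp

lemma tendsto_chiSqMellin_mul_exp {j : ℕ} (hj : 0 < j) {s : ℂ} (hs : s.re = 0) :
    Tendsto (fun M : ℕ => chiSqMellin (j + 2 * M) s *
      Complex.exp (-chiSqMellinExponent (j + 2 * M) s)) atTop (nhds 1) := by
  rw [← tendsto_add_atTop_iff_nat 1]
  have h1 := tendsto_Gamma_ratio (x := j / 2) (s := s) (by simpa using hj) hs
  have hk : Tendsto (fun M : ℕ => j + 2 * (M + 1)) atTop atTop :=
    tendsto_atTop_mono (fun M => show M ≤ j + 2 * (M + 1) by omega) tendsto_id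
  have h2 : Tendsto (fun M : ℕ => ((1 / ((j + 2 * (M + 1) : ℕ) : ℝ) : ℝ) : ℂ)) atTop (nhds 0) := by
    have := (tendsto_one_div_atTop_nhds_zero_nat (𝕜 := ℝ)).comp hk
    exact_mod_cast (Complex.continuous_ofReal.tendsto 0).comp this
  have h3 : Tendsto (fun M : ℕ => Real.log (2 * M / ((j + 2 * (M + 1) : ℕ) : ℝ))) atTop
      (nhds 0) := by
    have e : Tendsto (fun M : ℕ => 1 - (j + 2 : ℝ) * (1 / ((j + 2 * (M + 1) : ℕ) : ℝ))) atTop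
        (nhds (1 - (j + 2) * 0)) :=
      ((((tendsto_one_div_atTop_nhds_zero_nat (𝕜 := ℝ)).comp hk)).const_mul _).const_sub _
    have := (Real.continuousAt_log (by norm_num : (1 - (j + 2) * 0 : ℝ) ≠ 0)).tendsto.comp e
    simp only [mul_zero, sub_zero, Real.log_one] at this
    refine this.congr fun M => ?_
    simp only [Function.comp]
    congr 1
    push_cast
    field_simp
    ring
  have h4 : Tendsto (fun M : ℕ => Complex.exp (
      s * (Real.log (2 * M / ((j + 2 * (M + 1) : ℕ) : ℝ)) : ℝ)
      + (s - s ^ 2) * ((1 / ((j + 2 * (M + 1) : ℕ) : ℝ) : ℝ) : ℂ))) atTop (nhds 1) := by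
    have e3 := ((Complex.continuous_ofReal.tendsto 0).comp h3).const_mul s
    have := (Complex.continuous_exp.tendsto _).comp (e3.add (h2.const_mul (s - s ^ 2)))
    simpa [Function.comp_def] using this
  have h5 := h1.mul h4
  rw [mul_one] at h5
  refine h5.congr' ?_
  filter_upwards [eventually_ne_atTop 0] with M hM
  have hM' : (M : ℂ) ≠ 0 := by exact_mod_cast hM
  have hMr : (M : ℝ) ≠ 0 := by exact_mod_cast hM
  have e1 : ((j + 2 * (M + 1) : ℕ) : ℂ) / 2 = j / 2 + (M + 1 : ℕ) := by push_cast; ring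
  rw [chiSqMellin, e1, add_right_comm (j / 2 : ℂ), Complex.cpow_def_of_ne_zero two_ne_zero,
    Complex.cpow_def_of_ne_zero hM', chiSqMellinExponent, Real.log_div (by positivity)
    (by positivity), Real.log_mul two_ne_zero hMr]
  rw [mul_assoc, ← Complex.exp_add, mul_div_assoc, mul_right_comm, ← Complex.exp_add, mul_comm]
  congr 2
  rw [← Complex.natCast_log, ← Complex.ofReal_ofNat 2, ← Complex.ofReal_log (by norm_num)]
  push_cast
  ring

lemma one_div_cube_le {k : ℕ} (hk : 0 < k) :
    1 / (k : ℝ) ^ 3 ≤ 2 * (1 / (k : ℝ) ^ 2 - 1 / ((k + 2 : ℕ) : ℝ) ^ 2) := by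
  have h1 : (1 : ℝ) ≤ k := by exact_mod_cast hk
  push_cast
  rw [div_sub_div _ _ (by positivity) (by positivity), mul_div_assoc', div_le_div_iff₀ (by positivity)
    (by positivity)]
  have : (k : ℝ) ^ 2 * (k + 2) ^ 2 ≤ k ^ 2 * (2 * (4 * k + 4) * k) := by
    gcongr
    nlinarith
  nlinarith

lemma exists_chiSqMellin_eq_exp {j : ℕ} (hj : 0 < j) {s : ℂ} (hs : s.re = 0)
    (hs' : ‖s‖ ≤ 1 / 4) :
    ∃ e : ℂ, chiSqMellin j s = Complex.exp (chiSqMellinExponent j s + e) ∧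
      ‖e‖ ≤ 40 * ‖s‖ * (1 / (j : ℝ) ^ 2) := by
  set d : ℕ → ℂ := fun l => chiSqMellinDefect (j + 2 * l) s with hd
  have hprod (M : ℕ) : chiSqMellin (j + 2 * M) s *
      Complex.exp (-chiSqMellinExponent (j + 2 * M) s) =
      Complex.exp (∑ l ∈ Finset.range M, d l) *
        (chiSqMellin j s * Complex.exp (-chiSqMellinExponent j s)) := by
    induction M with
    | zero => simp
    | succ M ih =>
      rw [Finset.sum_range_succ, show j + 2 * (M + 1) = (j + 2 * M) + 2 by ring,
        chiSqMellin_mul_exp_add_two (by omega) hs, ih, Complex.exp_add]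
      ring
  have hbound (M : ℕ) : ∑ l ∈ Finset.range M, ‖d l‖ ≤ 40 * ‖s‖ * (1 / (j : ℝ) ^ 2) := by
    have : ∑ l ∈ Finset.range M, ‖d l‖ ≤
        40 * ‖s‖ * (1 / (j : ℝ) ^ 2 - 1 / ((j + 2 * M : ℕ) : ℝ) ^ 2) := by
      induction M with
      | zero => simp
      | succ M ih =>
        rw [Finset.sum_range_succ]
        have h1 := norm_chiSqMellinDefect_le (j := j + 2 * M) (by omega) hs'
        have h2 := mul_le_mul_of_nonneg_left (one_div_cube_le (k := j + 2 * M) (by omega))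
          (by positivity : 0 ≤ 20 * ‖s‖)
        rw [mul_one_div] at h2
        rw [show j + 2 * (M + 1) = (j + 2 * M) + 2 by ring]
        linarith
    refine this.trans ?_
    gcongr
    simp only [sub_le_self_iff]
    positivity
  have hsum : Summable fun l => ‖d l‖ :=
    summable_of_sum_range_le (fun _ => norm_nonneg _) hbound
  have hlim := hsum.of_norm.hasSum.tendsto_sum_nat
  have hone : Complex.exp (∑' l, d l) *
      (chiSqMellin j s * Complex.exp (-chiSqMellinExponent j s)) = 1 := by
    refine tendsto_nhds_unique ?_ (tendsto_chiSqMellin_mul_exp hj hs)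
    simp_rw [hprod]
    exact ((Complex.continuous_exp.tendsto _).comp hlim).mul_const _
  refine ⟨-∑' l, d l, ?_, ?_⟩
  · rw [Complex.exp_add, Complex.exp_neg]
    rw [Complex.exp_neg] at hone
    field_simp at hone ⊢
    exact hone
  · rw [norm_neg]
    exact (norm_tsum_le_tsum_norm hsum).trans
      (Real.tsum_le_of_sum_range_le (fun _ => norm_nonneg _) hbound)

lemma tendsto_prod_chiSqMellin (t : ℝ) :
    Tendsto (fun n : ℕ => (∏ j ∈ Finset.range n,
        chiSqMellin (j + 1) (Complex.I * (t / Real.sqrt (2 * Real.log n) : ℝ))) *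
        Complex.exp (-(Complex.I * (t / Real.sqrt (2 * Real.log n) : ℝ)) *
          Real.log ((n - 1).factorial)))
      atTop (nhds (Complex.exp (-t ^ 2 / 2))) := by
  set s : ℕ → ℂ := fun n => Complex.I * (t / Real.sqrt (2 * Real.log n) : ℝ) with hs
  have hlog : Tendsto (fun n : ℕ => Real.log n) atTop atTop :=
    Real.tendsto_log_atTop.comp tendsto_natCast_atTop_atTop
  have hs0 : Tendsto s atTop (nhds 0) := by
    have h : Tendsto (fun n : ℕ => t / Real.sqrt (2 * Real.log n)) atTop (nhds 0) :=
      (Real.tendsto_sqrt_atTop.comp (hlog.const_mul_atTop two_pos)).const_div_atTop t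
    have := ((Complex.continuous_ofReal.tendsto 0).comp h).const_mul Complex.I
    rwa [Complex.ofReal_zero, mul_zero] at this
  have hre (n : ℕ) : (s n).re = 0 := by rw [Complex.I_mul_re, Complex.ofReal_im, neg_zero]
  have hsmall : ∀ᶠ n in atTop, ‖s n‖ ≤ 1 / 4 := by
    have := hs0.norm
    rw [norm_zero] at this
    exact this.eventually_le_const (by norm_num)
  choose! e he using fun (n : ℕ) (hn : ‖s n‖ ≤ 1 / 4) (j : ℕ) =>
    exists_chiSqMellin_eq_exp (j := j + 1) (by omega) (hre n) hn
  have hsq : Summable fun j : ℕ => 1 / ((j + 1 : ℕ) : ℝ) ^ 2 :=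
    (summable_nat_add_iff 1).2 (Real.summable_one_div_nat_pow.2 one_lt_two)
  have herr : Tendsto (fun n => ∑ j ∈ Finset.range n, e n j) atTop (nhds 0) := by
    have hlim : Tendsto (fun n => 40 * ‖s n‖ * ∑' j : ℕ, 1 / ((j + 1 : ℕ) : ℝ) ^ 2) atTop
        (nhds 0) := by
      simpa only [norm_zero, mul_zero, zero_mul] using
        (hs0.norm.const_mul 40).mul_const (∑' j : ℕ, 1 / ((j + 1 : ℕ) : ℝ) ^ 2)
    refine squeeze_zero_norm' ?_ hlim
    filter_upwards [hsmall] with n hn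
    calc _ ≤ ∑ j ∈ Finset.range n, 40 * ‖s n‖ * (1 / ((j + 1 : ℕ) : ℝ) ^ 2) :=
          norm_sum_le_of_le _ fun j _ => (he n hn j).2
      _ = 40 * ‖s n‖ * ∑ j ∈ Finset.range n, 1 / ((j + 1 : ℕ) : ℝ) ^ 2 := by
          rw [Finset.mul_sum]
      _ ≤ _ := by
          gcongr
          exact hsq.sum_le_tsum _ fun _ _ => by positivity
  have hharm : Tendsto (fun n : ℕ => ((((harmonic n : ℚ) : ℝ) - Real.log n : ℝ) : ℂ)) atTop
      (nhds Real.eulerMascheroniConstant) :=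
    (Complex.continuous_ofReal.tendsto _).comp Real.tendsto_harmonic_sub_log
  have hmain : Tendsto (fun n : ℕ => (∑ j ∈ Finset.range n, e n j) +
      (s n ^ 2 - s n) * ((((harmonic n : ℚ) : ℝ) - Real.log n : ℝ) : ℂ) + -t ^ 2 / 2) atTop
      (nhds (0 + (0 ^ 2 - 0) * (Real.eulerMascheroniConstant : ℂ) + -t ^ 2 / 2)) :=
    (herr.add (((hs0.pow 2).sub hs0).mul hharm)).add_const _
  rw [show (0 + (0 ^ 2 - 0) * (Real.eulerMascheroniConstant : ℂ) + -t ^ 2 / 2 : ℂ) =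
    -t ^ 2 / 2 by ring] at hmain
  refine ((Complex.continuous_exp.tendsto _).comp hmain).congr' ?_
  filter_upwards [hsmall, eventually_ge_atTop 2] with n hn hn2
  simp only [Function.comp]
  have hln : 0 < Real.log n := Real.log_pos (by exact_mod_cast hn2)
  rw [Finset.prod_congr rfl fun j _ => (he n hn j).1, ← Complex.exp_sum, ← Complex.exp_add]
  congr 1
  have hH : ∑ j ∈ Finset.range n, (1 / ((j + 1 : ℕ) : ℂ)) = ((harmonic n : ℚ) : ℝ) := by
    simp [harmonic]
  have hF : ∑ j ∈ Finset.range n, ((Real.log (j + 1 : ℕ) : ℝ) : ℂ) =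
      (Real.log n : ℝ) + (Real.log (n - 1).factorial : ℝ) := by
    rw [← Complex.ofReal_sum, ← Complex.ofReal_add, ← Real.log_mul (by positivity) (by positivity),
      ← Real.log_prod (fun j _ => by positivity), ← Nat.cast_mul,
      Nat.mul_factorial_pred (by omega), ← Finset.prod_range_add_one_eq_factorial]
    push_cast; rfl
  have hs2 : s n ^ 2 * Real.log n = -t ^ 2 / 2 := by
    simp only [hs]
    rw [mul_pow, Complex.I_sq, ← Complex.ofReal_pow, div_pow, Real.sq_sqrt (by positivity)]
    push_cast
    have : (Real.log n : ℂ) ≠ 0 := by exact_mod_cast hln.ne'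
    rw [← Complex.natCast_log]
    field_simp
  have hE : ∑ j ∈ Finset.range n, (chiSqMellinExponent (j + 1) (s n) + e n j) =
      s n * (∑ j ∈ Finset.range n, ((Real.log (j + 1 : ℕ) : ℝ) : ℂ)) +
      (s n ^ 2 - s n) * (∑ j ∈ Finset.range n, (1 / ((j + 1 : ℕ) : ℂ))) +
      ∑ j ∈ Finset.range n, e n j := by
    rw [Finset.mul_sum, Finset.mul_sum, ← Finset.sum_add_distrib, ← Finset.sum_add_distrib]
    refine Finset.sum_congr rfl fun j _ => ?_
    rw [chiSqMellinExponent]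
    ring
  change _ = _ + -s n * _
  rw [hE, hH, hF, ← hs2]
  push_cast
  ring

section stdGaussianNorm

variable {E : Type*} [NormedAddCommGroup E] [InnerProductSpace ℝ E] [FiniteDimensional ℝ E]
  [MeasurableSpace E] [BorelSpace E]

lemma stdGaussian_eq_withDensity :
    stdGaussian E = (volume : Measure E).withDensity fun x => ENNReal.ofReal
      (((2 * Real.pi) ^ (Module.finrank ℝ E / 2 : ℝ))⁻¹ * Real.exp (-(1 / 2) * ‖x‖ ^ 2)) := by
  set c : ℝ := (2 * Real.pi) ^ (Module.finrank ℝ E / 2 : ℝ) with hc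
  have hcpos : 0 < c := by positivity
  have hint : Integrable (fun x : E => c⁻¹ * Real.exp (-(1 / 2) * ‖x‖ ^ 2)) := by
    have h := (GaussianFourier.integrable_cexp_neg_mul_sq_norm_add (V := E) (b := 1 / 2)
      (by norm_num) 0 0).norm.const_mul c⁻¹
    refine h.congr (ae_of_all _ fun x => ?_)
    simp only [zero_mul, add_zero, Complex.norm_exp]
    congr 2
    rw [← Complex.ofReal_pow, Complex.re_mul_ofReal]
    norm_num
  have := isFiniteMeasure_withDensity_ofReal hint.2
  apply Measure.ext_of_charFun
  ext t
  rw [charFun_stdGaussian, charFun_apply,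
    integral_withDensity_eq_integral_toReal_smul (by fun_prop) (by simp)]
  have h := GaussianFourier.integral_cexp_neg_mul_sq_norm_add (V := E) (b := 1 / 2)
      (by norm_num) Complex.I t
  have hc' : ((Real.pi / (1 / 2) : ℂ)) ^ (Module.finrank ℝ E / 2 : ℂ) = c := by
    rw [hc, Complex.ofReal_cpow (by positivity)]
    push_cast
    congr 1
    ring
  have e (x : E) : (ENNReal.ofReal (c⁻¹ * Real.exp (-(1 / 2) * ‖x‖ ^ 2))).toReal •
      Complex.exp (inner ℝ x t * Complex.I) =
      (c⁻¹ : ℂ) * Complex.exp (-(1 / 2) * ‖x‖ ^ 2 + Complex.I * inner ℝ t x) := by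
    rw [ENNReal.toReal_ofReal (by positivity), Complex.real_smul, Complex.exp_add,
      real_inner_comm, mul_comm Complex.I]
    push_cast
    ring
  simp_rw [e]
  rw [integral_const_mul, h, hc', inv_mul_cancel_left₀ (by exact_mod_cast hcpos.ne'),
    Complex.I_sq]
  congr 1
  ring

lemma integral_Ioi_pow_mul_exp_mul_sq_cpow {d : ℕ} (hd : 0 < d) {s : ℂ} (hs : s.re = 0) :
    ∫ y in Set.Ioi (0 : ℝ), y ^ (d - 1) • (((Real.exp (-(1 / 2) * y ^ 2) : ℝ) : ℂ) *
      ((y ^ 2 : ℝ) : ℂ) ^ s) =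
      2⁻¹ * (2 ^ (d / 2 + s : ℂ) * Complex.Gamma (d / 2 + s)) := by
  have h := Complex.integral_cpow_mul_exp_neg_mul_Ioi (a := d / 2 + s) (r := 1 / 2)
    (by simpa [hs] using hd) (by norm_num)
  rw [← integral_comp_rpow_Ioi_of_pos (p := 2) two_pos] at h
  have e : (1 / ((1 / 2 : ℝ) : ℂ)) = 2 := by norm_num
  rw [e] at h
  rw [← h, ← integral_const_mul]
  refine setIntegral_congr_fun measurableSet_Ioi fun y hy => ?_
  have hy : 0 < y := hy
  have hyc : (y : ℂ) ≠ 0 := by exact_mod_cast hy.ne'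
  have h2 : (y : ℂ) ^ (d - 1) = ((y ^ 2 : ℝ) : ℂ) ^ ((d : ℂ) / 2 - 1) * y := by
    rw [← Complex.ofReal_natCast d, ← Complex.ofReal_ofNat 2, ← Complex.ofReal_div,
      ← Complex.ofReal_one, ← Complex.ofReal_sub, ← Complex.ofReal_cpow (by positivity),
      ← Complex.ofReal_mul, ← Complex.ofReal_pow]
    congr 1
    rw [← Real.rpow_natCast y 2, ← Real.rpow_mul hy.le, ← Real.rpow_add_one hy.ne',
      ← Real.rpow_natCast, Nat.cast_sub hd]
    congr 1
    push_cast
    ring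
  have h3 : (d / 2 + s - 1 : ℂ) = (d / 2 - 1) + s := by ring
  have hy2 : ((y ^ 2 : ℝ) : ℂ) ≠ 0 := by exact_mod_cast (by positivity : y ^ 2 ≠ 0)
  simp only [Complex.real_smul, Real.rpow_two]
  rw [h3, Complex.cpow_add _ _ hy2, Complex.ofReal_pow y (d - 1), h2]
  norm_num
  ring_nf

lemma integral_norm_sq_cpow_stdGaussian [Nontrivial E] {s : ℂ} (hs : s.re = 0) :
    ∫ x : E, ((‖x‖ ^ 2 : ℝ) : ℂ) ^ s ∂(stdGaussian E) = chiSqMellin (Module.finrank ℝ E) s := by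
  set d := Module.finrank ℝ E with hd
  have hdpos : 0 < d := Module.finrank_pos
  obtain ⟨C, hC⟩ : ∃ C : ℂ, ∀ s : ℂ, s.re = 0 →
      ∫ x : E, ((‖x‖ ^ 2 : ℝ) : ℂ) ^ s ∂(stdGaussian E) =
        C * (2 ^ (d / 2 + s : ℂ) * Complex.Gamma (d / 2 + s)) := by
    refine ⟨d * ((volume : Measure E).real (Metric.ball 0 1)) *
      (((2 * Real.pi) ^ (d / 2 : ℝ) : ℝ) : ℂ)⁻¹ * 2⁻¹, fun s hs => ?_⟩
    rw [stdGaussian_eq_withDensity,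
      integral_withDensity_eq_integral_toReal_smul (by fun_prop) (by simp)]
    have h := integral_fun_norm_addHaar (volume : Measure E) (fun y : ℝ =>
      ((Real.exp (-(1 / 2) * y ^ 2) : ℝ) : ℂ) * ((y ^ 2 : ℝ) : ℂ) ^ s)
    rw [integral_Ioi_pow_mul_exp_mul_sq_cpow hdpos hs] at h
    have hc (x : E) : (ENNReal.ofReal (((2 * Real.pi) ^ (d / 2 : ℝ))⁻¹ *
        Real.exp (-(1 / 2) * ‖x‖ ^ 2))).toReal • ((‖x‖ ^ 2 : ℝ) : ℂ) ^ s =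
        (((2 * Real.pi) ^ (d / 2 : ℝ) : ℝ) : ℂ)⁻¹ *
          (((Real.exp (-(1 / 2) * ‖x‖ ^ 2) : ℝ) : ℂ) * ((‖x‖ ^ 2 : ℝ) : ℂ) ^ s) := by
      rw [ENNReal.toReal_ofReal (by positivity), Complex.real_smul]
      push_cast
      ring
    simp_rw [← hd, hc]
    rw [integral_const_mul, h, nsmul_eq_mul, Complex.real_smul]
    ring
  have h0 := hC 0 rfl
  have hΓ : Complex.Gamma (d / 2) ≠ 0 := by
    apply Complex.Gamma_ne_zero_of_re_pos
    simpa using hdpos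
  simp only [Complex.cpow_zero, integral_const, probReal_univ, one_smul, add_zero] at h0
  rw [hC s hs, chiSqMellin, Complex.cpow_add _ _ two_ne_zero, eq_div_iff hΓ]
  linear_combination (-(2 ^ s * Complex.Gamma (d / 2 + s))) * h0

end stdGaussianNorm

/-- The law of a vector of `N` independent standard Gaussian variables. -/
noncomputable abbrev stdGaussianPi (N : ℕ) : Measure (Fin N → ℝ) :=
  Measure.pi fun _ => gaussianReal 0 1

/-- The law of an `M × N` matrix with independent standard Gaussian entries. -/
noncomputable abbrev gaussianMatrix (M N : ℕ) : Measure (Fin M → Fin N → ℝ) :=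
  Measure.pi fun _ => stdGaussianPi N

lemma measurePreserving_swap_pi_pi {ι κ α : Type*} [Fintype ι] [Fintype κ] [MeasurableSpace α]
    (μ : Measure α) [IsProbabilityMeasure μ] :
    MeasurePreserving (fun (Z : ι → κ → α) j i => Z i j)
      (Measure.pi fun _ : ι => Measure.pi fun _ : κ => μ)
      (Measure.pi fun _ : κ => Measure.pi fun _ : ι => μ) := by
  refine ⟨by fun_prop, ?_⟩
  have h1 : MeasurePreserving (MeasurableEquiv.curry ι κ α).symm
      (Measure.pi fun _ : ι => Measure.pi fun _ : κ => μ) (Measure.pi fun _ : ι × κ => μ) := by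
    refine ⟨by fun_prop, ?_⟩
    have := Measure.infinitePi_map_curry_symm (fun (_ : ι) (_ : κ) => μ)
    simpa only [Measure.infinitePi_eq_pi] using this
  have h2 := measurePreserving_piCongrLeft (fun _ : κ × ι => μ) (Equiv.prodComm ι κ)
  have h3 : MeasurePreserving (MeasurableEquiv.curry κ ι α)
      (Measure.pi fun _ : κ × ι => μ) (Measure.pi fun _ : κ => Measure.pi fun _ : ι => μ) := by
    refine ⟨by fun_prop, ?_⟩
    have := Measure.infinitePi_map_curry (fun (_ : κ) (_ : ι) => μ)
    simpa only [Measure.infinitePi_eq_pi] using this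
  convert! (h3.comp (h2.comp h1)).map_eq using 2

lemma measurePreserving_tail_stdGaussianPi (N : ℕ) :
    MeasurePreserving (fun x : Fin (N + 1) → ℝ => Fin.tail x) (stdGaussianPi (N + 1))
      (stdGaussianPi N) :=
  measurePreserving_snd.comp
    (measurePreserving_piFinSuccAbove (fun _ : Fin (N + 1) => gaussianReal 0 1) 0)

lemma measurePreserving_toLp_stdGaussianPi (N : ℕ) :
    MeasurePreserving (WithLp.toLp 2) (stdGaussianPi N) (stdGaussian (EuclideanSpace ℝ (Fin N))) :=
  ⟨by fun_prop, map_pi_eq_stdGaussian⟩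

lemma measurePreserving_isometry_stdGaussianPi {N : ℕ}
    (L : EuclideanSpace ℝ (Fin N) ≃ₗᵢ[ℝ] EuclideanSpace ℝ (Fin N)) :
    MeasurePreserving (fun x : Fin N → ℝ => WithLp.ofLp (L (WithLp.toLp 2 x)))
      (stdGaussianPi N) (stdGaussianPi N) := by
  have h := measurePreserving_toLp_stdGaussianPi N
  have hL : MeasurePreserving L (stdGaussian (EuclideanSpace ℝ (Fin N)))
      (stdGaussian (EuclideanSpace ℝ (Fin N))) := ⟨L.continuous.measurable, stdGaussian_map L⟩
  have h' : MeasurePreserving (MeasurableEquiv.toLp 2 (Fin N → ℝ)) (stdGaussianPi N)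
      (stdGaussian (EuclideanSpace ℝ (Fin N))) := h
  exact (h'.symm.comp hL).comp h

/-- The squared determinant of the matrix with rows `Z i`. -/
noncomputable def detSq {N : ℕ} (Z : Fin N → Fin N → ℝ) : ℝ := (Matrix.of Z).det ^ 2

lemma detSq_nonneg {N : ℕ} (Z : Fin N → Fin N → ℝ) : 0 ≤ detSq Z := sq_nonneg _

lemma measurable_detSq {N : ℕ} : Measurable (detSq : (Fin N → Fin N → ℝ) → ℝ) := by
  have : Continuous (detSq : (Fin N → Fin N → ℝ) → ℝ) :=
    (Continuous.matrix_det (A := fun Z : Fin N → Fin N → ℝ => Matrix.of Z) continuous_id).pow 2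
  exact this.measurable

lemma detSq_eq_det_gram {N : ℕ} (Z : Fin N → Fin N → ℝ) :
    detSq Z = (Matrix.of fun i j => ∑ k, Z i k * Z j k).det := by
  rw [detSq, sq]
  nth_rewrite 2 [← Matrix.det_transpose]
  rw [← Matrix.det_mul]
  rfl

lemma detSq_isometry {N : ℕ} (L : EuclideanSpace ℝ (Fin N) ≃ₗᵢ[ℝ] EuclideanSpace ℝ (Fin N))
    (Z : Fin N → Fin N → ℝ) :
    detSq (fun i => WithLp.ofLp (L (WithLp.toLp 2 (Z i)))) = detSq Z := by
  rw [detSq_eq_det_gram, detSq_eq_det_gram]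
  congr 2
  ext i j
  have := L.inner_map_map (WithLp.toLp 2 (Z j)) (WithLp.toLp 2 (Z i))
  rw [PiLp.inner_apply, PiLp.inner_apply] at this
  simpa only [RCLike.inner_apply, conj_trivial] using this

lemma detSq_cons_single {N : ℕ} (r : ℝ) (Z : Fin N → Fin (N + 1) → ℝ) :
    detSq (Fin.cons (Pi.single 0 r) Z : Fin (N + 1) → Fin (N + 1) → ℝ) =
      r ^ 2 * detSq fun i => Fin.tail (Z i) := by
  rw [detSq, detSq, Matrix.det_succ_row_zero, Finset.sum_eq_single 0]
  · simp only [Matrix.of_apply, Fin.cons_zero, Pi.single_eq_same]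
    rw [← mul_pow]
    congr 1
    simp only [Fin.val_zero, pow_zero, one_mul]
    congr 2
  · intro j _ hj
    simp [hj]
  · simp

/-- Rotating the first row onto a coordinate axis reduces the determinant with one fixed row to
a Gaussian determinant of smaller size. -/
lemma exists_measurePreserving_detSq_cons {N : ℕ} (a : Fin (N + 1) → ℝ) :
    ∃ Φ : (Fin N → Fin (N + 1) → ℝ) → (Fin N → Fin N → ℝ),
      MeasurePreserving Φ (gaussianMatrix N (N + 1)) (gaussianMatrix N N) ∧
      ∀ Z, detSq (Fin.cons a Z : Fin (N + 1) → Fin (N + 1) → ℝ) =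
        (∑ i, a i ^ 2) * detSq (Φ Z) := by
  set v : EuclideanSpace ℝ (Fin (N + 1)) := WithLp.toLp 2 a with hv
  set w : EuclideanSpace ℝ (Fin (N + 1)) := EuclideanSpace.single 0 ‖v‖ with hw
  set L := (ℝ ∙ (v - w))ᗮ.reflection with hL
  have hLv : L v = w := Submodule.reflection_sub (by simp [hw])
  refine ⟨fun Z i => Fin.tail (WithLp.ofLp (L (WithLp.toLp 2 (Z i)))), ?_, fun Z => ?_⟩
  · exact measurePreserving_pi _ _ fun _ =>
      (measurePreserving_tail_stdGaussianPi N).comp (measurePreserving_isometry_stdGaussianPi L)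
  · rw [← detSq_isometry L]
    have h : (fun i => WithLp.ofLp (L (WithLp.toLp 2
        ((Fin.cons a Z : Fin (N + 1) → Fin (N + 1) → ℝ) i)))) =
        (Fin.cons (Pi.single 0 ‖v‖) fun i => WithLp.ofLp (L (WithLp.toLp 2 (Z i))) :
          Fin (N + 1) → Fin (N + 1) → ℝ) := by
      funext i
      refine Fin.cases ?_ (fun i => ?_) i
      · simp only [Fin.cons_zero]
        rw [← hv, hLv]
        rfl
      · simp only [Fin.cons_succ]
    rw [h, detSq_cons_single, EuclideanSpace.norm_sq_eq]
    simp [hv]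

lemma measurePreserving_cons_gaussianMatrix (N : ℕ) :
    MeasurePreserving (fun p : (Fin (N + 1) → ℝ) × (Fin N → Fin (N + 1) → ℝ) =>
        (Fin.cons p.1 p.2 : Fin (N + 1) → Fin (N + 1) → ℝ))
      ((stdGaussianPi (N + 1)).prod (gaussianMatrix N (N + 1))) (gaussianMatrix (N + 1) (N + 1)) := by
  have h := (measurePreserving_piFinSuccAbove (fun _ : Fin (N + 1) => stdGaussianPi (N + 1)) 0).symm
  convert! h using 1
  funext p
  simp [MeasurableEquiv.piFinSuccAbove, Fin.insertNthEquiv]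

lemma ae_stdGaussianPi_sum_sq_ne_zero (N : ℕ) :
    ∀ᵐ a ∂(stdGaussianPi (N + 1)), ∑ i, a i ^ 2 ≠ 0 := by
  have : NullSingletonClass (gaussianReal 0 1) := nullSingletonClass_gaussianReal one_ne_zero
  have : NullSingletonClass (stdGaussianPi (N + 1)) := Measure.pi_nullSingletonClass 0
  have h : ∀ᵐ a ∂(stdGaussianPi (N + 1)), a ≠ 0 := by
    simp [ae_iff]
  filter_upwards [h] with a ha h0
  apply ha
  funext i
  rw [Finset.sum_eq_zero_iff_of_nonneg fun _ _ => sq_nonneg _] at h0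
  simpa using h0 i (Finset.mem_univ i)

lemma ae_gaussianMatrix_detSq_ne_zero (N : ℕ) : ∀ᵐ Z ∂(gaussianMatrix N N), detSq Z ≠ 0 := by
  induction N with
  | zero => exact ae_of_all _ fun Z => by simp [detSq]
  | succ N ih =>
    have hm : MeasurableSet {Z : Fin (N + 1) → Fin (N + 1) → ℝ | detSq Z ≠ 0} :=
      (measurable_detSq (measurableSet_singleton 0)).compl
    have hc := measurePreserving_cons_gaussianMatrix N
    rw [← hc.map_eq, ae_map_iff hc.measurable.aemeasurable hm]
    refine (Measure.ae_prod_iff_ae_ae (p := fun p : (Fin (N + 1) → ℝ) × (Fin N → Fin (N + 1) → ℝ) =>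
      detSq (Fin.cons p.1 p.2 : Fin (N + 1) → Fin (N + 1) → ℝ) ≠ 0) (hc.measurable hm)).2 ?_
    filter_upwards [ae_stdGaussianPi_sum_sq_ne_zero N] with a ha
    obtain ⟨Φ, hΦ, hdet⟩ := exists_measurePreserving_detSq_cons a
    filter_upwards [hΦ.quasiMeasurePreserving.ae ih] with Z hZ
    simp only [hdet]
    exact mul_ne_zero ha hZ

lemma norm_ofReal_cpow_le_one {x : ℝ} (hx : 0 ≤ x) {s : ℂ} (hs : s.re = 0) :
    ‖(x : ℂ) ^ s‖ ≤ 1 := by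
  rcases hx.eq_or_lt with rfl | hx
  · by_cases h : s = 0
    · simp [h]
    · simp [Complex.zero_cpow h]
  · rw [Complex.norm_cpow_eq_rpow_re_of_pos hx, hs, Real.rpow_zero]

lemma integral_detSq_cpow {s : ℂ} (hs : s.re = 0) (N : ℕ) :
    ∫ Z, (detSq Z : ℂ) ^ s ∂(gaussianMatrix N N) =
      ∏ j ∈ Finset.range N, chiSqMellin (j + 1) s := by
  induction N with
  | zero => simp [detSq]
  | succ N ih =>
    have hm {M : ℕ} : Measurable fun Z : Fin M → Fin M → ℝ => (detSq Z : ℂ) ^ s :=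
      (Complex.measurable_ofReal.comp measurable_detSq).pow_const s
    have hc := measurePreserving_cons_gaussianMatrix N
    rw [← hc.map_eq, integral_map hc.measurable.aemeasurable hm.aestronglyMeasurable]
    refine (integral_prod (fun p : (Fin (N + 1) → ℝ) × (Fin N → Fin (N + 1) → ℝ) =>
      (detSq (Fin.cons p.1 p.2 : Fin (N + 1) → Fin (N + 1) → ℝ) : ℂ) ^ s)
      (Integrable.of_bound (hm.comp hc.measurable).aestronglyMeasurable 1
        (ae_of_all _ fun _ => norm_ofReal_cpow_le_one (detSq_nonneg _) hs))).trans ?_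
    have hinner (a : Fin (N + 1) → ℝ) :
        ∫ Z, (detSq (Fin.cons a Z : Fin (N + 1) → Fin (N + 1) → ℝ) : ℂ) ^ s
          ∂(gaussianMatrix N (N + 1)) =
        ((∑ i, a i ^ 2 : ℝ) : ℂ) ^ s * ∏ j ∈ Finset.range N, chiSqMellin (j + 1) s := by
      obtain ⟨Φ, hΦ, hdet⟩ := exists_measurePreserving_detSq_cons a
      rw [← ih, ← hΦ.map_eq, integral_map hΦ.measurable.aemeasurable hm.aestronglyMeasurable,
        ← integral_const_mul]
      congr 1 with Z
      rw [hdet, Complex.ofReal_mul, Complex.mul_cpow_ofReal_nonneg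
        (Finset.sum_nonneg fun _ _ => sq_nonneg _) (detSq_nonneg _)]
    simp_rw [hinner]
    rw [integral_mul_const, Finset.prod_range_succ, mul_comm]
    congr 1
    have h := integral_norm_sq_cpow_stdGaussian (E := EuclideanSpace ℝ (Fin (N + 1))) hs
    have hmp := measurePreserving_toLp_stdGaussianPi (N + 1)
    rw [finrank_euclideanSpace_fin, ← hmp.map_eq, integral_map hmp.measurable.aemeasurable
      (by exact (Measurable.pow_const (by fun_prop) s).aestronglyMeasurable)] at h
    rw [← h]
    simp [EuclideanSpace.norm_sq_eq]

/-- The normalised logarithm of the squared determinant. -/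
noncomputable def logDetStat {n : ℕ} (Z : Fin n → Fin n → ℝ) : ℝ :=
  (Real.log (detSq Z) - Real.log (Nat.factorial (n - 1))) / Real.sqrt (2 * Real.log n)

lemma measurable_logDetStat {n : ℕ} :
    Measurable (logDetStat : (Fin n → Fin n → ℝ) → ℝ) :=
  ((Real.measurable_log.comp measurable_detSq).sub_const _).div_const _

lemma charFun_map_logDetStat (n : ℕ) (t : ℝ) :
    charFun ((gaussianMatrix n n).map logDetStat) t =
      (∏ j ∈ Finset.range n,
        chiSqMellin (j + 1) (Complex.I * (t / Real.sqrt (2 * Real.log n) : ℝ))) *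
      Complex.exp (-(Complex.I * (t / Real.sqrt (2 * Real.log n) : ℝ)) *
        Real.log ((n - 1).factorial)) := by
  rw [charFun_apply_real, integral_map measurable_logDetStat.aemeasurable
    (by exact (Measurable.aestronglyMeasurable (by fun_prop))), ← integral_detSq_cpow
      (by rw [Complex.I_mul_re, Complex.ofReal_im, neg_zero]),
    ← integral_mul_const]
  refine integral_congr_ae ?_
  filter_upwards [ae_gaussianMatrix_detSq_ne_zero n] with Z hZ
  rw [Complex.cpow_def_of_ne_zero (by exact_mod_cast hZ), ← Complex.ofReal_log (detSq_nonneg Z),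
    ← Complex.exp_add]
  congr 1
  simp only [logDetStat]
  push_cast
  ring

lemma tendsto_gaussianMatrix_logDetStat_le (x : ℝ) :
    Tendsto (fun n : ℕ => (gaussianMatrix n n {Z | logDetStat Z ≤ x}).toReal) atTop
      (nhds (stdGaussianCDF x)) := by
  have hprob (n : ℕ) : IsProbabilityMeasure ((gaussianMatrix n n).map logDetStat) :=
    Measure.isProbabilityMeasure_map measurable_logDetStat.aemeasurable
  let μ : ℕ → ProbabilityMeasure ℝ := fun n => ⟨(gaussianMatrix n n).map logDetStat, hprob n⟩
  let γ : ProbabilityMeasure ℝ := ⟨gaussianReal 0 1, inferInstance⟩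
  have hlim : Tendsto μ atTop (nhds γ) := by
    rw [ProbabilityMeasure.tendsto_iff_tendsto_charFun]
    intro t
    have h := tendsto_prod_chiSqMellin t
    simp_rw [← charFun_map_logDetStat] at h
    convert! h using 2
    simp only [γ, ProbabilityMeasure.coe_mk, charFun_gaussianReal]
    congr 1
    push_cast
    ring
  have hfr : (γ : Measure ℝ) (frontier (Set.Iic x)) = 0 := by
    have : NullSingletonClass (gaussianReal 0 1) := nullSingletonClass_gaussianReal one_ne_zero
    rw [frontier_Iic]
    exact measure_singleton (μ := gaussianReal 0 1) x
  have h := ProbabilityMeasure.tendsto_measure_of_null_frontier_of_tendsto' hlim hfr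
  have h' := (ENNReal.tendsto_toReal (measure_ne_top _ _)).comp h
  refine h'.congr fun n => ?_
  simp only [Function.comp_apply, μ, ProbabilityMeasure.coe_mk]
  rw [Measure.map_apply measurable_logDetStat measurableSet_Iic]
  rfl

lemma measurable_add_mulVec {p : ℕ} (m : Fin p → ℝ) (A : Matrix (Fin p) (Fin p) ℝ) :
    Measurable fun z : Fin p → ℝ => m + A *ᵥ z :=
  (Continuous.add continuous_const
    (Continuous.matrix_mulVec continuous_const continuous_id)).measurable

lemma integral_exp_affine_stdGaussianPi {p : ℕ} (m : Fin p → ℝ) (A : Matrix (Fin p) (Fin p) ℝ)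
    (l : Fin p → ℝ) :
    ∫ z, Complex.exp ((∑ i, l i * (m + A *ᵥ z) i : ℝ) * Complex.I) ∂(stdGaussianPi p) =
      Complex.exp ((∑ i, l i * m i : ℝ) * Complex.I - (l ⬝ᵥ ((A * Aᵀ) *ᵥ l) : ℝ) / 2) := by
  have hlin (z : Fin p → ℝ) : ∑ i, l i * (m + A *ᵥ z) i = ∑ i, l i * m i + z ⬝ᵥ (Aᵀ *ᵥ l) := by
    have : ∑ i, l i * (m + A *ᵥ z) i = l ⬝ᵥ (m + A *ᵥ z) := rfl
    rw [this, dotProduct_add, dotProduct_mulVec, ← mulVec_transpose, dotProduct_comm _ z]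
    rfl
  have hquad : l ⬝ᵥ ((A * Aᵀ) *ᵥ l) = ‖(WithLp.toLp 2 (Aᵀ *ᵥ l) : EuclideanSpace ℝ (Fin p))‖ ^ 2 := by
    rw [EuclideanSpace.real_norm_sq_eq, ← mulVec_mulVec, dotProduct_mulVec, ← mulVec_transpose]
    simp [dotProduct, sq]
  have h := charFun_stdGaussian (WithLp.toLp 2 (Aᵀ *ᵥ l) : EuclideanSpace ℝ (Fin p))
  have hmp := measurePreserving_toLp_stdGaussianPi p
  rw [charFun_apply, ← hmp.map_eq, integral_map hmp.measurable.aemeasurable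
    (by exact (Measurable.aestronglyMeasurable (by fun_prop)))] at h
  simp_rw [hlin, Complex.ofReal_add, add_mul, Complex.exp_add]
  rw [integral_const_mul, sub_eq_add_neg, Complex.exp_add, hquad]
  congr 1
  convert! h using 2
  · funext z
    congr 2
    simp [PiLp.inner_apply, dotProduct, mul_comm]
  · push_cast
    ring

/-- A Gaussian vector is an affine image of a standard Gaussian vector. -/
lemma IsMvGaussian.eq_map {p : ℕ} {m : Fin p → ℝ} {A : Matrix (Fin p) (Fin p) ℝ}
    {ν : Measure (Fin p → ℝ)} (hν : IsMvGaussian m (A * Aᵀ) ν) :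
    ν = (stdGaussianPi p).map fun z => m + A *ᵥ z := by
  have := hν.1
  have hmeas := measurable_add_mulVec m A
  have := Measure.isProbabilityMeasure_map (μ := stdGaussianPi p) hmeas.aemeasurable
  apply Measure.ext_of_charFunDual
  ext L
  obtain ⟨l, hl⟩ : ∃ l : Fin p → ℝ, ∀ x, L x = ∑ i, l i * x i := by
    refine ⟨fun i => L (Pi.single i 1), fun x => ?_⟩
    conv_lhs => rw [pi_eq_sum_univ' x]
    rw [map_sum]
    refine Finset.sum_congr rfl fun i _ => ?_
    rw [map_smul, smul_eq_mul, mul_comm]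
  have hpsd : 0 ≤ l ⬝ᵥ ((A * Aᵀ) *ᵥ l) := by
    rw [← mulVec_mulVec, dotProduct_mulVec, ← mulVec_transpose]
    exact Finset.sum_nonneg fun i _ => mul_self_nonneg _
  rw [charFunDual_apply (μ := (stdGaussianPi p).map _),
    integral_map hmeas.aemeasurable (by exact (Measurable.aestronglyMeasurable (by fun_prop)))]
  simp_rw [hl]
  rw [integral_exp_affine_stdGaussianPi, charFunDual_eq_charFun_map_one,
    show (⇑L : (Fin p → ℝ) → ℝ) = fun x => ∑ i, l i * x i from funext hl, hν.2 l,
    charFun_gaussianReal, Real.coe_toNNReal _ hpsd]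
  simp

/-- The data matrix with rows `X k` minus their sample mean. -/
noncomputable def centeredData {n p : ℕ} (X : Fin (n + 1) → Fin p → ℝ) :
    Matrix (Fin (n + 1)) (Fin p) ℝ :=
  Matrix.of fun k i => X k i - (∑ l, X l i) / (n + 1)

lemma sampleCov_eq_smul {n p : ℕ} (X : Fin (n + 1) → Fin p → ℝ) :
    sampleCov X = (1 / (n : ℝ)) • ((centeredData X)ᵀ * centeredData X) := by
  ext i j
  simp [sampleCov, centeredData, Matrix.mul_apply]

lemma sum_centeredData {n p : ℕ} (X : Fin (n + 1) → Fin p → ℝ) (i : Fin p) :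
    ∑ k, centeredData X k i = 0 := by
  have : (n : ℝ) + 1 ≠ 0 := by positivity
  simp only [centeredData, Matrix.of_apply, Finset.sum_sub_distrib, Finset.sum_const,
    Finset.card_univ, Fintype.card_fin, nsmul_eq_mul]
  push_cast
  field_simp
  ring

lemma centeredData_affine {n p : ℕ} (m : Fin p → ℝ) (A : Matrix (Fin p) (Fin p) ℝ)
    (Z : Fin (n + 1) → Fin p → ℝ) :
    centeredData (fun k => m + A *ᵥ Z k) = centeredData Z * Aᵀ := by
  have h0 : (n : ℝ) + 1 ≠ 0 := by positivity
  ext k i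
  have hsum : ∑ l, (A *ᵥ Z l) i = ∑ j, A i j * ∑ l, Z l j := by
    simp only [mulVec, dotProduct, Finset.mul_sum]
    exact Finset.sum_comm
  simp only [centeredData, Matrix.of_apply, Matrix.mul_apply, Matrix.transpose_apply,
    Pi.add_apply, Finset.sum_add_distrib, Finset.sum_const, Finset.card_univ, Fintype.card_fin,
    nsmul_eq_mul, hsum]
  simp only [sub_mul, Finset.sum_sub_distrib, mulVec, dotProduct]
  have h1 : ∑ j, (∑ l, Z l j) / (n + 1 : ℝ) * A i j = (∑ j, A i j * ∑ l, Z l j) / (n + 1) := by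
    rw [Finset.sum_div]
    exact Finset.sum_congr rfl fun _ _ => by ring
  rw [h1]
  simp only [mul_comm (Z k _)]
  push_cast
  field_simp
  ring

lemma det_sampleCov_affine {n p : ℕ} (m : Fin p → ℝ) (A : Matrix (Fin p) (Fin p) ℝ)
    (Z : Fin (n + 1) → Fin p → ℝ) :
    (sampleCov fun k => m + A *ᵥ Z k).det =
      (1 / (n : ℝ)) ^ p * ((A * Aᵀ).det * ((centeredData Z)ᵀ * centeredData Z).det) := by
  rw [sampleCov_eq_smul, Matrix.det_smul, centeredData_affine, Matrix.transpose_mul,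
    Matrix.transpose_transpose, Fintype.card_fin,
    show A * (centeredData Z)ᵀ * (centeredData Z * Aᵀ) =
      A * ((centeredData Z)ᵀ * centeredData Z) * Aᵀ by simp only [Matrix.mul_assoc],
    Matrix.det_mul, Matrix.det_mul, Matrix.det_mul]
  ring

/-- The constant unit vector of `ℝ ^ (n + 1)`. -/
noncomputable def unitConst (n : ℕ) : Fin (n + 1) → ℝ := fun _ => 1 / Real.sqrt (n + 1)

lemma sum_unitConst_sq (n : ℕ) : ∑ i, unitConst n i ^ 2 = 1 := by
  have : (n : ℝ) + 1 ≠ 0 := by positivity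
  simp only [unitConst, Finset.sum_const, Finset.card_univ, Fintype.card_fin, nsmul_eq_mul,
    div_pow, one_pow, Real.sq_sqrt (by positivity : (0 : ℝ) ≤ n + 1)]
  push_cast
  field_simp

lemma det_centeredData_gram {n : ℕ} (Z : Fin (n + 1) → Fin n → ℝ) :
    ((centeredData Z)ᵀ * centeredData Z).det =
      detSq (Fin.cons (unitConst n) fun i k => Z k i : Fin (n + 1) → Fin (n + 1) → ℝ) := by
  have hsq : Real.sqrt (n + 1) ≠ 0 := by positivity
  have hrow : detSq (Fin.cons (unitConst n) fun i k => Z k i : Fin (n + 1) → Fin (n + 1) → ℝ) =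
      detSq (Fin.cons (unitConst n) fun i k => centeredData Z k i : Fin (n + 1) → Fin (n + 1) → ℝ) := by
    rw [detSq, detSq]
    congr 1
    refine Matrix.det_eq_of_forall_row_eq_smul_add_const
      (Fin.cons 0 fun i => (∑ l, Z l i) / (n + 1) * Real.sqrt (n + 1)) 0 rfl fun i j => ?_
    refine Fin.cases ?_ (fun i => ?_) i
    · simp
    · simp [centeredData, unitConst, hsq]
  rw [hrow, detSq_eq_det_gram, Matrix.det_succ_row_zero, Finset.sum_eq_single 0]
  · simp only [Matrix.of_apply, Fin.cons_zero, ← sq, sum_unitConst_sq, Fin.val_zero, pow_zero,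
      one_pow, one_mul]
    rfl
  · intro j _ hj
    obtain ⟨j, rfl⟩ := Fin.exists_succ_eq.2 hj
    have : ∑ k, unitConst n k * centeredData Z k j = 0 := by
      simp only [unitConst, ← Finset.mul_sum, sum_centeredData, mul_zero]
    simp [this]
  · simp

lemma measurable_det_sampleCov {n p : ℕ} :
    Measurable fun X : Fin (n + 1) → Fin p → ℝ => (sampleCov X).det := by
  refine (Continuous.matrix_det (continuous_matrix fun i j => ?_)).measurable
  simp only [sampleCov, Matrix.of_apply]
  fun_prop

/-- A positive semidefinite real matrix is of the form `A * Aᵀ`. -/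
lemma exists_eq_mul_transpose_of_posSemidef {p : ℕ} {S : Matrix (Fin p) (Fin p) ℝ}
    (hS : S.PosSemidef) : ∃ A : Matrix (Fin p) (Fin p) ℝ, S = A * Aᵀ := by
  open scoped MatrixOrder in
  obtain ⟨X, hX, -, h⟩ := CFC.exists_sqrt_of_isSelfAdjoint_of_quasispectrumRestricts
    hS.isHermitian (QuasispectrumRestricts.nnreal_of_nonneg hS.nonneg)
  refine ⟨X, ?_⟩
  have hXt : Xᵀ = X := by
    rw [← conjTranspose_eq_transpose_of_trivial]
    exact hX
  rw [hXt, h]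

/-- The normalised log determinant of the sample covariance matrix of `n + 1` Gaussian vectors in
dimension `n` has the law of `logDetStat` of a square Gaussian matrix. -/
lemma measure_pi_log_det_sampleCov_le {n : ℕ} (hn : n ≠ 0) {m : Fin n → ℝ}
    {S : Matrix (Fin n) (Fin n) ℝ} (hS : S.PosDef) {ν : Measure (Fin n → ℝ)}
    (hν : IsMvGaussian m S ν) (x : ℝ) :
    (Measure.pi fun _ : Fin (n + 1) => ν)
        {X : Fin (n + 1) → Fin n → ℝ |
          (Real.log (sampleCov X).det - Real.log (Nat.factorial (n - 1)) +
                n * Real.log n - Real.log S.det) / Real.sqrt (2 * Real.log n) ≤ x} =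
      gaussianMatrix n n {Z | logDetStat Z ≤ x} := by
  have := hν.1
  have hdetS : S.det ≠ 0 := hS.det_pos.ne'
  obtain ⟨A, rfl⟩ := exists_eq_mul_transpose_of_posSemidef hS.posSemidef
  obtain ⟨Φ, hΦ, hdet⟩ := exists_measurePreserving_detSq_cons (unitConst n)
  have hΨ : MeasurePreserving (fun (Z : Fin (n + 1) → Fin n → ℝ) k => m + A *ᵥ Z k)
      (gaussianMatrix (n + 1) n) (Measure.pi fun _ : Fin (n + 1) => ν) :=
    measurePreserving_pi _ _ fun _ => ⟨measurable_add_mulVec m A, hν.eq_map.symm⟩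
  have hΘ := hΦ.comp (measurePreserving_swap_pi_pi (ι := Fin (n + 1)) (κ := Fin n)
    (gaussianReal 0 1))
  have hmeas := ((((measurable_det_sampleCov (n := n) (p := n)).log.sub_const
    (Real.log (Nat.factorial (n - 1)))).add_const (n * Real.log n)).sub_const
    (Real.log (A * Aᵀ).det)).div_const (Real.sqrt (2 * Real.log n))
  rw [← hΨ.measure_preimage (measurableSet_le hmeas measurable_const).nullMeasurableSet,
    ← hΘ.measure_preimage (measurableSet_le measurable_logDetStat
      measurable_const).nullMeasurableSet]
  refine measure_congr (eventuallyEq_set.2 ?_)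
  filter_upwards [hΘ.quasiMeasurePreserving.ae (ae_gaussianMatrix_detSq_ne_zero n)] with Z hZ
  have hn' : (1 / (n : ℝ)) ^ n ≠ 0 := by positivity
  simp only [Function.comp_apply] at hZ
  simp only [Set.mem_preimage, Set.mem_ofPred_eq, logDetStat, Function.comp_apply]
  rw [det_sampleCov_affine, det_centeredData_gram, hdet, sum_unitConst_sq, one_mul,
    Real.log_mul hn' (mul_ne_zero hdetS hZ), Real.log_mul hdetS hZ, Real.log_pow, one_div,
    Real.log_inv]
  refine iff_of_eq (congrArg (· / _ ≤ x) ?_)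
  ring

/-- **CLT for the log determinant in the boundary case `p(n) = n`** (Corollary 2.3):
`(log det Σ̂ − log (n−1)! + n log n − log det Σ)/√(2 log n) → N(0,1)` in distribution. -/
theorem log_det_sample_cov_clt_boundary
    (m : ∀ n : ℕ, Fin n → ℝ)
    (S : ∀ n : ℕ, Matrix (Fin n) (Fin n) ℝ) (hS : ∀ n, (S n).PosDef)
    (ν : ∀ n : ℕ, Measure (Fin n → ℝ)) (hν : ∀ n, IsMvGaussian (m n) (S n) (ν n)) :
    ∀ x : ℝ,
      Tendsto
        (fun n =>
          ((Measure.pi fun _ : Fin (n + 1) => ν n)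
              {X : Fin (n + 1) → Fin n → ℝ |
                (Real.log (sampleCov X).det - Real.log (Nat.factorial (n - 1)) +
                      n * Real.log n - Real.log (S n).det) /
                    Real.sqrt (2 * Real.log n) ≤ x}).toReal)
        atTop (nhds (stdGaussianCDF x)) := by
  intro x
  refine (tendsto_gaussianMatrix_logDetStat_le x).congr' ?_
  filter_upwards [eventually_ne_atTop 0] with n hn
  rw [measure_pi_log_det_sampleCov_le hn (hS n) (hν n)]
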